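/- Let α, β > 1/2 and let H_N be the histopolation matrix [H_N]_{i,j} = (1/h_i)∫_{s_i} P_{j-1}^{(α+1,β+1)}(t) ω_{α,β}(t) dt, with D_h = diag(h_1,…,h_N). Then there is a constant C(α,β) > 0 such that for every j = 1,…,N, ∑_{i=1}^N h_i |[H_N]_{i,j}|² ≤ C(α,β)/j. -/

import Mathlib

/-- The Jacobi polynomial `P_n^{(a,b)}` via its explicit hypergeometric sum. -/
noncomputable def jacobiP (n : ℕ) (a b : ℝ) (x : ℝ) : ℝ :=
  Real.Gamma (a + n + 1) / ((n.factorial : ℝ) * Real.Gamma (a + b + n + 1)) *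
    ∑ m ∈ Finset.range (n + 1),
      (n.choose m : ℝ) * (Real.Gamma (a + b + n + m + 1) / Real.Gamma (a + m + 1)) *
        ((x - 1) / 2) ^ m

/-- The Jacobi weight `ω_{a,b}(t) = (1-t)^a (1+t)^b`. -/
noncomputable def jacobiW (a b t : ℝ) : ℝ := (1 - t) ^ a * (1 + t) ^ b

/-- The Jacobi polynomial as a polynomial in the variable `(x - 1) / 2`. -/
noncomputable def jacobiPoly (n : ℕ) (a b : ℝ) : Polynomial ℝ :=
  ∑ m ∈ Finset.range (n + 1), Polynomial.C
    (Real.Gamma (a + n + 1) / ((n.factorial : ℝ) * Real.Gamma (a + b + n + 1)) *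
      ((n.choose m : ℝ) * (Real.Gamma (a + b + n + m + 1) / Real.Gamma (a + m + 1)))) *
        Polynomial.X ^ m

theorem jacobiP_eq_eval (n : ℕ) (a b x : ℝ) :
    jacobiP n a b x = (jacobiPoly n a b).eval ((x - 1) / 2) := by
  simp [jacobiP, jacobiPoly, Polynomial.eval_finsetSum, Finset.mul_sum, mul_assoc]

theorem coeff_jacobiPoly (n : ℕ) (a b : ℝ) (m : ℕ) :
    (jacobiPoly n a b).coeff m =
      Real.Gamma (a + n + 1) / ((n.factorial : ℝ) * Real.Gamma (a + b + n + 1)) *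
      ((n.choose m : ℝ) * (Real.Gamma (a + b + n + m + 1) / Real.Gamma (a + m + 1))) := by
  rw [jacobiPoly, Polynomial.finsetSum_coeff]
  simp only [Polynomial.coeff_C_mul_X_pow]
  rw [Finset.sum_ite_eq]
  split_ifs with h
  · rfl
  · rw [Nat.choose_eq_zero_of_lt (by simpa using h)]
    simp

theorem derivative_jacobiPoly_succ (n : ℕ) {a b : ℝ} (ha : 0 ≤ a) (hb : 0 ≤ b) :
    Polynomial.derivative (jacobiPoly (n + 1) a b) =
      Polynomial.C (n + a + b + 2) * jacobiPoly n (a + 1) (b + 1) := by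
  ext m
  rw [Polynomial.coeff_derivative, Polynomial.coeff_C_mul, coeff_jacobiPoly, coeff_jacobiPoly]
  have hchoose : ((n + 1).choose (m + 1) : ℝ) * (m + 1) = (n + 1) * n.choose m := by
    exact_mod_cast (Nat.add_one_mul_choose_eq n m).symm
  have hfac : ((n + 1).factorial : ℝ) = (n + 1) * n.factorial := by
    exact_mod_cast Nat.factorial_succ n
  have hgamma : Real.Gamma (a + 1 + (b + 1) + n + 1) =
      (n + a + b + 2) * Real.Gamma (a + b + (n + 1 : ℕ) + 1) := by
    rw [show a + 1 + (b + 1) + n + 1 = (n + a + b + 2) + 1 by ring,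
      Real.Gamma_add_one (by positivity)]
    congr 2
    push_cast
    ring
  have hpos : 0 < Real.Gamma (a + b + (n + 1 : ℕ) + 1) := Real.Gamma_pos_of_pos (by positivity)
  have hpos' : 0 < Real.Gamma (a + 1 + m + 1) := Real.Gamma_pos_of_pos (by positivity)
  have hfac_pos : (0 : ℝ) < n.factorial := by exact_mod_cast n.factorial_pos
  have hlin : 0 < n + a + b + 2 := by positivity
  rw [hfac, hgamma,
    show a + b + (n + 1 : ℕ) + (m + 1 : ℕ) + 1 = a + 1 + (b + 1) + n + m + 1 by push_cast; ring,
    show a + (m + 1 : ℕ) + 1 = a + 1 + m + 1 by push_cast; ring,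
    show a + (n + 1 : ℕ) + 1 = a + 1 + n + 1 by push_cast; ring]
  field_simp
  linear_combination hchoose

theorem jacobiPoly_ode (n : ℕ) {a b : ℝ} (ha : 0 ≤ a) (hb : 0 ≤ b) :
    (Polynomial.X + Polynomial.X ^ 2) *
        Polynomial.derivative (Polynomial.derivative (jacobiPoly n a b)) +
      (Polynomial.C (a + 1) + Polynomial.C (a + b + 2) * Polynomial.X) *
        Polynomial.derivative (jacobiPoly n a b) =
      Polynomial.C (n * (n + a + b + 1)) * jacobiPoly n a b := by
  have hrec : ∀ m : ℕ, (m + 1) * (m + a + 1) * (jacobiPoly n a b).coeff (m + 1) =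
      (n - m) * (n + m + a + b + 1) * (jacobiPoly n a b).coeff m := by
    intro m
    rw [coeff_jacobiPoly, coeff_jacobiPoly]
    have hchoose : (n.choose (m + 1) : ℝ) * (m + 1) = n.choose m * (n - m) := by
      rcases le_or_gt m n with h | h
      · have := Nat.choose_succ_right_eq n m
        rw [← Nat.cast_sub h]
        exact_mod_cast this
      · simp [Nat.choose_eq_zero_of_lt h, Nat.choose_eq_zero_of_lt (h.trans (Nat.lt_succ_self m))]
    have h1 : Real.Gamma (a + b + n + (m + 1 : ℕ) + 1) =
        (n + m + a + b + 1) * Real.Gamma (a + b + n + m + 1) := by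
      rw [show a + b + n + (m + 1 : ℕ) + 1 = (n + m + a + b + 1) + 1 by push_cast; ring,
        Real.Gamma_add_one (by positivity)]
      congr 2
      ring
    have h2 : Real.Gamma (a + (m + 1 : ℕ) + 1) = (m + a + 1) * Real.Gamma (a + m + 1) := by
      rw [show a + (m + 1 : ℕ) + 1 = (m + a + 1) + 1 by push_cast; ring,
        Real.Gamma_add_one (by positivity)]
      congr 2
      ring
    have hpos : 0 < Real.Gamma (a + m + 1) := Real.Gamma_pos_of_pos (by positivity)
    have hlin : 0 < m + a + 1 := by positivity
    rw [h1, h2]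
    field_simp
    linear_combination hchoose
  ext m
  have hm := hrec m
  rcases m with _ | _ | m <;>
  simp only [add_mul, Polynomial.coeff_add, mul_assoc, Polynomial.coeff_C_mul, pow_two,
    Polynomial.coeff_X_mul, Polynomial.coeff_X_mul_zero,
    Polynomial.coeff_derivative] <;> push_cast at hm ⊢ <;> linear_combination hm

theorem hasDerivAt_eval_half (p : Polynomial ℝ) (t : ℝ) :
    HasDerivAt (fun x => p.eval ((x - 1) / 2)) (p.derivative.eval ((t - 1) / 2) / 2) t := by
  have h := (p.hasDerivAt ((t - 1) / 2)).comp t (((hasDerivAt_id t).sub_const 1).div_const 2)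
  exact h.congr_deriv (by ring)

theorem jacobiP_zero {a b : ℝ} (ha : 0 ≤ a) (hb : 0 ≤ b) (x : ℝ) : jacobiP 0 a b x = 1 := by
  have h1 := (Real.Gamma_pos_of_pos (by positivity : 0 < a + 1)).ne'
  have h2 := (Real.Gamma_pos_of_pos (by positivity : 0 < a + b + 1)).ne'
  simp [jacobiP]
  field_simp

theorem hasDerivAt_jacobiP_succ (n : ℕ) {a b : ℝ} (ha : 0 ≤ a) (hb : 0 ≤ b) (t : ℝ) :
    HasDerivAt (jacobiP (n + 1) a b)
      ((n + a + b + 2) / 2 * jacobiP n (a + 1) (b + 1) t) t := by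
  have h := hasDerivAt_eval_half (jacobiPoly (n + 1) a b) t
  rw [derivative_jacobiPoly_succ n ha hb, Polynomial.eval_mul, Polynomial.eval_C,
    ← jacobiP_eq_eval] at h
  simp only [← jacobiP_eq_eval] at h
  convert h using 1
  ring

theorem continuous_jacobiP (n : ℕ) (a b : ℝ) : Continuous (jacobiP n a b) := by
  unfold jacobiP
  fun_prop

/-- `P`, with first and second derivatives `P₁` and `P₂`, solves the Jacobi differential equation
with parameters `a`, `b` and eigenvalue `l`. -/
structure IsJacobiSolution (a b l : ℝ) (P P₁ P₂ : ℝ → ℝ) : Prop where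
  deriv₁ : ∀ t, HasDerivAt P (P₁ t) t
  deriv₂ : ∀ t, HasDerivAt P₁ (P₂ t) t
  ode : ∀ t, (1 - t) * (1 + t) * P₂ t + ((b + 1) * (1 - t) - (a + 1) * (1 + t)) * P₁ t +
    l * P t = 0

theorem isJacobiSolution_jacobiP (n : ℕ) {a b : ℝ} (ha : 0 ≤ a) (hb : 0 ≤ b) :
    IsJacobiSolution a b (n * (n + a + b + 1)) (jacobiP n a b)
      (fun t => (jacobiPoly n a b).derivative.eval ((t - 1) / 2) / 2)
      (fun t => (jacobiPoly n a b).derivative.derivative.eval ((t - 1) / 2) / 2 / 2) where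
  deriv₁ t := by
    rw [show jacobiP n a b = _ from funext (jacobiP_eq_eval n a b)]
    exact hasDerivAt_eval_half _ t
  deriv₂ t := (hasDerivAt_eval_half _ t).div_const 2
  ode t := by
    have h := congrArg (Polynomial.eval ((t - 1) / 2)) (jacobiPoly_ode n ha hb)
    simp only [Polynomial.eval_add, Polynomial.eval_mul, Polynomial.eval_pow, Polynomial.eval_X,
      Polynomial.eval_C, ← jacobiP_eq_eval] at h
    linear_combination -h

theorem IsJacobiSolution.comp_neg {a b l : ℝ} {P P₁ P₂ : ℝ → ℝ}
    (h : IsJacobiSolution a b l P P₁ P₂) :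
    IsJacobiSolution b a l (fun t => P (-t)) (fun t => -P₁ (-t)) (fun t => P₂ (-t)) where
  deriv₁ t := by
    exact ((h.deriv₁ (-t)).comp t (hasDerivAt_neg t)).congr_deriv (by ring)
  deriv₂ t := by
    exact ((h.deriv₂ (-t)).comp t (hasDerivAt_neg t)).neg.congr_deriv (by ring)
  ode t := by
    linear_combination h.ode (-t)

theorem IsJacobiSolution.continuous {a b l : ℝ} {P P₁ P₂ : ℝ → ℝ}
    (h : IsJacobiSolution a b l P P₁ P₂) : Continuous P :=
  continuous_iff_continuousAt.2 fun t => (h.deriv₁ t).continuousAt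

theorem IsJacobiSolution.continuous_deriv {a b l : ℝ} {P P₁ P₂ : ℝ → ℝ}
    (h : IsJacobiSolution a b l P P₁ P₂) : Continuous P₁ :=
  continuous_iff_continuousAt.2 fun t => (h.deriv₂ t).continuousAt

theorem continuous_jacobiW {a b : ℝ} (ha : 0 ≤ a) (hb : 0 ≤ b) : Continuous (jacobiW a b) :=
  ((Real.continuous_rpow_const ha).comp (continuous_const.sub continuous_id)).mul
    ((Real.continuous_rpow_const hb).comp (continuous_const.add continuous_id))

theorem jacobiW_nonneg (a b : ℝ) {t : ℝ} (ht : t ∈ Set.Icc (-1 : ℝ) 1) : 0 ≤ jacobiW a b t :=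
  mul_nonneg (Real.rpow_nonneg (by linarith [ht.2]) _) (Real.rpow_nonneg (by linarith [ht.1]) _)

theorem jacobiW_neg (a b t : ℝ) : jacobiW a b (-t) = jacobiW b a t := by
  simp [jacobiW, mul_comm, sub_eq_add_neg]

theorem jacobiW_add_natCast (a b : ℝ) (m n : ℕ) {t : ℝ} (ht : t ∈ Set.Ioo (-1 : ℝ) 1) :
    jacobiW (a + m) (b + n) t = (1 - t) ^ m * (1 + t) ^ n * jacobiW a b t := by
  rw [jacobiW, jacobiW, Real.rpow_add_natCast (by linarith [ht.2]),
    Real.rpow_add_natCast (by linarith [ht.1])]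
  ring

theorem jacobiW_one {a b : ℝ} (ha : a ≠ 0) : jacobiW a b 1 = 0 := by
  simp [jacobiW, Real.zero_rpow ha]

theorem jacobiW_neg_one {a b : ℝ} (hb : b ≠ 0) : jacobiW a b (-1) = 0 := by
  simp [jacobiW, Real.zero_rpow hb]

theorem hasDerivAt_jacobiW_add_one (a b : ℝ) {t : ℝ} (ht : t ∈ Set.Ioo (-1 : ℝ) 1) :
    HasDerivAt (jacobiW (a + 1) (b + 1))
      (((b + 1) * (1 - t) - (a + 1) * (1 + t)) * jacobiW a b t) t := by
  have hs : (0 : ℝ) < 1 - t := by linarith [ht.2]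
  have hr : (0 : ℝ) < 1 + t := by linarith [ht.1]
  have h1 := ((hasDerivAt_id t).const_sub 1).rpow_const (p := a + 1) (Or.inl hs.ne')
  have h2 := ((hasDerivAt_id t).const_add 1).rpow_const (p := b + 1) (Or.inl hr.ne')
  refine (h1.mul h2).congr_deriv ?_
  simp only [id, add_sub_cancel_right, jacobiW, Real.rpow_add_one hs.ne', Real.rpow_add_one hr.ne']
  ring

theorem integral_eq_zero_of_hasDerivAt {F F' : ℝ → ℝ} (hF : Continuous F) (hF' : Continuous F')
    (h : ∀ t ∈ Set.Ioo (-1 : ℝ) 1, HasDerivAt F (F' t) t) (hleft : F (-1) = 0)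
    (hright : F 1 = 0) : ∫ t in (-1 : ℝ)..1, F' t = 0 := by
  rw [intervalIntegral.integral_eq_sub_of_hasDerivAt_of_le (by norm_num) hF.continuousOn h
    (hF'.intervalIntegrable _ _), hleft, hright, sub_zero]

theorem IsJacobiSolution.integral_deriv_sq {a b l : ℝ} {P P₁ P₂ : ℝ → ℝ}
    (h : IsJacobiSolution a b l P P₁ P₂) (ha : 0 ≤ a) (hb : 0 ≤ b) :
    ∫ t in (-1 : ℝ)..1, P₁ t ^ 2 * jacobiW (a + 1) (b + 1) t =
      l * ∫ t in (-1 : ℝ)..1, P t ^ 2 * jacobiW a b t := by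
  have hP := h.continuous
  have hP₁ := h.continuous_deriv
  have hW := continuous_jacobiW ha hb
  have hW₁ := continuous_jacobiW (a := a + 1) (b := b + 1) (by positivity) (by positivity)
  have key : ∫ t in (-1 : ℝ)..1,
      (P₁ t ^ 2 * jacobiW (a + 1) (b + 1) t - l * (P t ^ 2 * jacobiW a b t)) = 0 := by
    refine integral_eq_zero_of_hasDerivAt (F := fun t => jacobiW (a + 1) (b + 1) t * (P t * P₁ t))
      (by fun_prop) (by fun_prop) (fun t ht => ?_) ?_ ?_
    · refine ((hasDerivAt_jacobiW_add_one a b ht).mul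
        ((h.deriv₁ t).mul (h.deriv₂ t))).congr_deriv ?_
      have hw := jacobiW_add_natCast a b 1 1 ht
      simp only [Nat.cast_one, pow_one] at hw
      simp only [Pi.mul_apply, hw]
      linear_combination jacobiW a b t * P t * h.ode t
    · simp [jacobiW_neg_one (a := a + 1) (b := b + 1) (by positivity)]
    · simp [jacobiW_one (a := a + 1) (b := b + 1) (by positivity)]
  rw [intervalIntegral.integral_sub (Continuous.intervalIntegrable (by fun_prop) _ _)
    (Continuous.intervalIntegrable (by fun_prop) _ _), intervalIntegral.integral_const_mul] at key
  linarith

theorem integral_jacobiW {a b : ℝ} (ha : 0 ≤ a) (hb : 0 ≤ b) :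
    ∫ t in (-1 : ℝ)..1, jacobiW a b t =
      2 ^ (a + b + 1) * (Real.Gamma (a + 1) * Real.Gamma (b + 1) / Real.Gamma (a + b + 2)) := by
  have hbeta : ∫ x in (0 : ℝ)..1, x ^ b * (1 - x) ^ a =
      Real.Gamma (a + 1) * Real.Gamma (b + 1) / Real.Gamma (a + b + 2) := by
    have h := Complex.betaIntegral_eq_Gamma_mul_div ((b + 1 : ℝ) : ℂ) ((a + 1 : ℝ) : ℂ)
      (by simp; linarith) (by simp; linarith)
    rw [← Complex.ofReal_add, Complex.Gamma_ofReal, Complex.Gamma_ofReal, Complex.Gamma_ofReal,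
      Complex.betaIntegral] at h
    apply Complex.ofReal_injective
    rw [← intervalIntegral.integral_ofReal, show a + b + 2 = b + 1 + (a + 1) by ring,
      mul_comm (Real.Gamma (a + 1))]
    push_cast
    rw [Complex.ofReal_add] at h
    push_cast at h
    rw [← h]
    refine intervalIntegral.integral_congr fun x hx => ?_
    rw [Set.uIcc_of_le zero_le_one] at hx
    have h1 := Complex.ofReal_cpow hx.1 b
    have h2 := Complex.ofReal_cpow (sub_nonneg.2 hx.2) a
    push_cast at h2
    simp [h1, h2]
  have hsubst := intervalIntegral.integral_comp_mul_sub (a := 0) (b := 1) (jacobiW a b)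
    (two_ne_zero (α := ℝ)) 1
  rw [smul_eq_mul, show (2 : ℝ) * 0 - 1 = -1 by norm_num, show (2 : ℝ) * 1 - 1 = 1 by norm_num]
    at hsubst
  have hscale : ∫ x in (0 : ℝ)..1, jacobiW a b (2 * x - 1) =
      2 ^ (a + b) * ∫ x in (0 : ℝ)..1, x ^ b * (1 - x) ^ a := by
    rw [← intervalIntegral.integral_const_mul]
    refine intervalIntegral.integral_congr fun x hx => ?_
    rw [Set.uIcc_of_le zero_le_one] at hx
    simp only [jacobiW]
    rw [show 1 - (2 * x - 1) = 2 * (1 - x) by ring, show 1 + (2 * x - 1) = 2 * x by ring,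
      Real.mul_rpow zero_le_two (sub_nonneg.2 hx.2), Real.mul_rpow zero_le_two hx.1,
      Real.rpow_add zero_lt_two]
    ring
  rw [Real.rpow_add_one two_ne_zero, ← hbeta]
  linarith

theorem integral_jacobiP_sq (n : ℕ) {a b : ℝ} (ha : 0 ≤ a) (hb : 0 ≤ b) :
    ∫ t in (-1 : ℝ)..1, jacobiP n a b t ^ 2 * jacobiW a b t =
      2 ^ (a + b + 1) / (2 * n + a + b + 1) *
        (Real.Gamma (n + a + 1) * Real.Gamma (n + b + 1) /
          (n.factorial * Real.Gamma (n + a + b + 1))) := by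
  induction n generalizing a b with
  | zero =>
    have hpos : 0 < Real.Gamma (a + b + 1) := Real.Gamma_pos_of_pos (by positivity)
    have hlin : 0 < a + b + 1 := by positivity
    simp only [jacobiP_zero ha hb, one_pow, one_mul, integral_jacobiW ha hb]
    rw [show a + b + 2 = a + b + 1 + 1 by ring, Real.Gamma_add_one hlin.ne']
    simp only [Nat.cast_zero, Nat.factorial_zero, Nat.cast_one, zero_add, mul_zero, one_mul]
    field_simp
  | succ n ih =>
    have hode := isJacobiSolution_jacobiP (n + 1) ha hb
    have h := hode.integral_deriv_sq ha hb
    have hderiv : ∀ t, (Polynomial.derivative (jacobiPoly (n + 1) a b)).eval ((t - 1) / 2) / 2 =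
        (n + a + b + 2) / 2 * jacobiP n (a + 1) (b + 1) t := fun t =>
      (hode.deriv₁ t).unique (hasDerivAt_jacobiP_succ n ha hb t)
    simp only [hderiv, mul_pow, mul_assoc, intervalIntegral.integral_const_mul] at h
    rw [ih (by positivity) (by positivity)] at h
    have hlin : 0 < n + a + b + 2 := by positivity
    have hlin' : 0 < 2 * n + a + b + 3 := by positivity
    have hpos : 0 < Real.Gamma (n + a + b + 2) := Real.Gamma_pos_of_pos (by positivity)
    have hfac_pos : (0 : ℝ) < n.factorial := by exact_mod_cast n.factorial_pos
    have hfac : ((n + 1).factorial : ℝ) = (n + 1) * n.factorial := by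
      exact_mod_cast Nat.factorial_succ n
    rw [show a + 1 + (b + 1) + 1 = a + b + 1 + 2 by ring, Real.rpow_add zero_lt_two _ 2,
      Real.rpow_two,
      show 2 * (n : ℝ) + (a + 1) + (b + 1) + 1 = 2 * n + a + b + 3 by ring,
      show (n : ℝ) + (a + 1) + (b + 1) + 1 = n + a + b + 2 + 1 by ring,
      Real.Gamma_add_one hlin.ne', Nat.cast_add_one] at h
    rw [hfac, Nat.cast_add_one,
      show 2 * ((n : ℝ) + 1) + a + b + 1 = 2 * n + a + b + 3 by ring,
      show (n : ℝ) + 1 + a + 1 = n + (a + 1) + 1 by ring,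
      show (n : ℝ) + 1 + b + 1 = n + (b + 1) + 1 by ring,
      show (n : ℝ) + 1 + a + b + 1 = n + a + b + 2 by ring]
    have hn : (0 : ℝ) < n + 1 := by positivity
    rw [show (n : ℝ) + 1 + a + b + 1 = n + a + b + 2 by ring] at h
    have hl : ((n : ℝ) + 1) * (n + a + b + 2) ≠ 0 := by positivity
    apply mul_left_cancel₀ hl
    rw [mul_assoc, ← h]
    field_simp

theorem gamma_mul_gamma_le {x a b : ℝ} (hx : 0 < x) (ha : 0 < a) (hb : 0 < b) :
    Real.Gamma (x + a) * Real.Gamma (x + b) ≤ Real.Gamma x * Real.Gamma (x + a + b) := by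
  have hxpos := Real.Gamma_pos_of_pos hx
  have hypos : 0 < Real.Gamma (x + a + b) := Real.Gamma_pos_of_pos (by positivity)
  have h1 := Real.Gamma_mul_add_mul_le_rpow_Gamma_mul_rpow_Gamma hx
    (by positivity : 0 < x + a + b) (by positivity : 0 < b / (a + b))
    (by positivity : 0 < a / (a + b)) (by field_simp; ring)
  have h2 := Real.Gamma_mul_add_mul_le_rpow_Gamma_mul_rpow_Gamma hx
    (by positivity : 0 < x + a + b) (by positivity : 0 < a / (a + b))
    (by positivity : 0 < b / (a + b)) (by field_simp)
  rw [show b / (a + b) * x + a / (a + b) * (x + a + b) = x + a by field_simp; ring] at h1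
  rw [show a / (a + b) * x + b / (a + b) * (x + a + b) = x + b by field_simp; ring] at h2
  calc _ ≤ _ := mul_le_mul h1 h2 (Real.Gamma_pos_of_pos (by positivity)).le (by positivity)
    _ = (Real.Gamma x ^ (b / (a + b)) * Real.Gamma x ^ (a / (a + b))) *
        (Real.Gamma (x + a + b) ^ (a / (a + b)) * Real.Gamma (x + a + b) ^ (b / (a + b))) := by
      ring
    _ = _ := by
      rw [← Real.rpow_add hxpos, ← Real.rpow_add hypos, ← add_div, ← add_div, add_comm b a,
        div_self (by positivity), Real.rpow_one, Real.rpow_one]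

theorem integral_jacobiP_sq_le (n : ℕ) {a b : ℝ} (ha : 0 < a) (hb : 0 < b) :
    ∫ t in (-1 : ℝ)..1, jacobiP n a b t ^ 2 * jacobiW a b t ≤ 2 ^ (a + b + 1) / (n + 1) := by
  have hpos : 0 < Real.Gamma (n + a + b + 1) := Real.Gamma_pos_of_pos (by positivity)
  have hratio : Real.Gamma (n + a + 1) * Real.Gamma (n + b + 1) /
      (n.factorial * Real.Gamma (n + a + b + 1)) ≤ 1 := by
    rw [← Real.Gamma_nat_eq_factorial, div_le_one (mul_pos (Real.Gamma_pos_of_pos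
      (by positivity)) hpos)]
    have h := gamma_mul_gamma_le (x := n + 1) (by positivity) ha hb
    rwa [add_right_comm (n : ℝ) 1 a, add_right_comm (n : ℝ) 1 b,
      add_right_comm ((n : ℝ) + a) 1 b] at h
  rw [integral_jacobiP_sq n ha.le hb.le]
  calc _ ≤ 2 ^ (a + b + 1) / (2 * n + a + b + 1) * 1 := by gcongr
    _ ≤ _ := by
      rw [mul_one]
      gcongr
      linarith [(Nat.cast_nonneg n : (0 : ℝ) ≤ n)]

theorem jacobiW_eq_pow_mul {a b a' b' : ℝ} (m n : ℕ) (ha : a' = a + m) (hb : b' = b + n) {t : ℝ}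
    (ht : t ∈ Set.Ioo (-1 : ℝ) 1) :
    jacobiW a' b' t = (1 - t) ^ m * (1 + t) ^ n * jacobiW a b t := by
  rw [ha, hb, jacobiW_add_natCast a b m n ht]

/-- A virial identity for the Jacobi equation, localised at the endpoint `1`. -/
theorem IsJacobiSolution.integral_virial_eq_zero {a b l : ℝ} {P P₁ P₂ : ℝ → ℝ}
    (h : IsJacobiSolution a b l P P₁ P₂) (ha : 3 / 2 < a) (hb : 0 < b) :
    ∫ t in (-1 : ℝ)..1, P t ^ 2 *
      (-(l * (a - 3 / 2)) * jacobiW (2 * a - 2) (2 * b + 1) t +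
        l * (b + 1 / 2) * jacobiW (2 * a - 1) (2 * b) t +
        ((b + 1) * (5 - 4 * a) * jacobiW (2 * a - 2) (2 * b + 1) t +
          (b + 1) * (2 * b + 1) * jacobiW (2 * a - 1) (2 * b) t -
          (2 - a) * (2 * a - 2) * jacobiW (2 * a - 3) (2 * b + 2) t) / 2) = 0 := by
  have hP := h.continuous
  have hP₁ := h.continuous_deriv
  have hW₁ := continuous_jacobiW (a := 2 * a - 2) (b := 2 * b + 1) (by linarith) (by linarith)
  have hW₂ := continuous_jacobiW (a := 2 * a - 1) (b := 2 * b) (by linarith) (by linarith)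
  have hW₃ := continuous_jacobiW (a := 2 * a - 3) (b := 2 * b + 2) (by linarith) (by linarith)
  have hV₁ := continuous_jacobiW (a := 2 * a - 1 + 1) (b := 2 * b + 1 + 1)
    (by linarith) (by linarith)
  have hV₂ := continuous_jacobiW (a := 2 * a - 2 + 1) (b := 2 * b + 1) (by linarith) (by linarith)
  have hV₃ := continuous_jacobiW (a := 2 * a - 2 + 1) (b := 2 * b + 1 + 1)
    (by linarith) (by linarith)
  have hV₄ := continuous_jacobiW (a := 2 * a - 3 + 1) (b := 2 * b + 1) (by linarith) (by linarith)
  refine integral_eq_zero_of_hasDerivAt (F := fun t =>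
    jacobiW (2 * a - 1 + 1) (2 * b + 1 + 1) t * (P₁ t * P₁ t) * (1 / 2) +
      jacobiW (2 * a - 2 + 1) (2 * b + 1) t * (P t * P t) * (l / 2) -
      jacobiW (2 * a - 2 + 1) (2 * b + 1 + 1) t * (P t * P₁ t) +
      jacobiW (2 * a - 3 + 1) (2 * b + 1) t * (P t * P t) *
        ((b + 1) / 2 * (1 - t) + (2 - a) / 2 * (1 + t))) (by fun_prop) (by fun_prop)
      (fun t ht => ?_) ?_ ?_
  · have hd₀ := h.deriv₁ t
    have hd₁ := h.deriv₂ t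
    have hs := ((hasDerivAt_id t).const_sub 1).const_mul ((b + 1) / 2)
    have hr := ((hasDerivAt_id t).const_add 1).const_mul ((2 - a) / 2)
    refine ((((((hasDerivAt_jacobiW_add_one (2 * a - 1) (2 * b + 1) ht).mul
      (hd₁.mul hd₁)).mul_const (1 / 2)).add
      (((hasDerivAt_jacobiW_add_one (2 * a - 2) (2 * b) ht).mul
        (hd₀.mul hd₀)).mul_const (l / 2))).sub
      ((hasDerivAt_jacobiW_add_one (2 * a - 2) (2 * b + 1) ht).mul (hd₀.mul hd₁))).add
      (((hasDerivAt_jacobiW_add_one (2 * a - 3) (2 * b) ht).mul (hd₀.mul hd₀)).mul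
        (hs.add hr))).congr_deriv ?_
    simp only [Pi.mul_apply, Pi.add_apply, id]
    rw [jacobiW_eq_pow_mul (a' := 2 * a - 1 + 1) (b' := 2 * b + 1 + 1) (a := 2 * a - 3)
        (b := 2 * b) 3 2 (by push_cast; ring) (by push_cast; ring) ht,
      jacobiW_eq_pow_mul (a' := 2 * a - 2 + 1) (b' := 2 * b + 1) (a := 2 * a - 3)
        (b := 2 * b) 2 1 (by push_cast; ring) (by push_cast; ring) ht,
      jacobiW_eq_pow_mul (a' := 2 * a - 2 + 1) (b' := 2 * b + 1 + 1) (a := 2 * a - 3)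
        (b := 2 * b) 2 2 (by push_cast; ring) (by push_cast; ring) ht,
      jacobiW_eq_pow_mul (a' := 2 * a - 3 + 1) (b' := 2 * b + 1) (a := 2 * a - 3)
        (b := 2 * b) 1 1 (by push_cast; ring) (by push_cast; ring) ht,
      jacobiW_eq_pow_mul (a' := 2 * a - 1) (b' := 2 * b + 1) (a := 2 * a - 3)
        (b := 2 * b) 2 1 (by push_cast; ring) (by push_cast; ring) ht,
      jacobiW_eq_pow_mul (a' := 2 * a - 2) (b' := 2 * b) (a := 2 * a - 3)
        (b := 2 * b) 1 0 (by push_cast; ring) (by push_cast; ring) ht,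
      jacobiW_eq_pow_mul (a' := 2 * a - 2) (b' := 2 * b + 1) (a := 2 * a - 3)
        (b := 2 * b) 1 1 (by push_cast; ring) (by push_cast; ring) ht,
      jacobiW_eq_pow_mul (a' := 2 * a - 1) (b' := 2 * b) (a := 2 * a - 3)
        (b := 2 * b) 2 0 (by push_cast; ring) (by push_cast; ring) ht,
      jacobiW_eq_pow_mul (a' := 2 * a - 3) (b' := 2 * b + 2) (a := 2 * a - 3)
        (b := 2 * b) 0 2 (by push_cast; ring) (by push_cast; ring) ht]
    linear_combination jacobiW (2 * a - 3) (2 * b) t * (1 - t) * (1 + t) *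
      ((1 - t) * P₁ t - P t) * h.ode t
  · have hz₁ := jacobiW_neg_one (a := 2 * a - 1 + 1) (b := 2 * b + 1 + 1) (by linarith)
    have hz₂ := jacobiW_neg_one (a := 2 * a - 2 + 1) (b := 2 * b + 1) (by linarith)
    have hz₃ := jacobiW_neg_one (a := 2 * a - 2 + 1) (b := 2 * b + 1 + 1) (by linarith)
    have hz₄ := jacobiW_neg_one (a := 2 * a - 3 + 1) (b := 2 * b + 1) (by linarith)
    simp only [hz₁, hz₂, hz₃, hz₄]
    ring
  · have hz₁ := jacobiW_one (a := 2 * a - 1 + 1) (b := 2 * b + 1 + 1) (by linarith)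
    have hz₂ := jacobiW_one (a := 2 * a - 2 + 1) (b := 2 * b + 1) (by linarith)
    have hz₃ := jacobiW_one (a := 2 * a - 2 + 1) (b := 2 * b + 1 + 1) (by linarith)
    have hz₄ := jacobiW_one (a := 2 * a - 3 + 1) (b := 2 * b + 1) (by linarith)
    simp only [hz₁, hz₂, hz₃, hz₄]
    ring

theorem IsJacobiSolution.integral_sq_mul_jacobiW_le {a b l : ℝ} {P P₁ P₂ : ℝ → ℝ}
    (h : IsJacobiSolution a b l P P₁ P₂) (ha : 3 / 2 < a) (ha' : a ≤ 2) (hb : 0 < b)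
    (hl : b + 1 ≤ l) :
    ∫ t in (-1 : ℝ)..1, P t ^ 2 * jacobiW (2 * a - 2) (2 * b + 1) t ≤
      (2 * b + 1) / (a - 3 / 2) *
        ∫ t in (-1 : ℝ)..1, P t ^ 2 * jacobiW (2 * a - 1) (2 * b) t := by
  have hP := h.continuous
  have hW₁ := continuous_jacobiW (a := 2 * a - 2) (b := 2 * b + 1) (by linarith) (by linarith)
  have hW₂ := continuous_jacobiW (a := 2 * a - 1) (b := 2 * b) (by linarith) (by linarith)
  have hW₃ := continuous_jacobiW (a := 2 * a - 3) (b := 2 * b + 2) (by linarith) (by linarith)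
  have hle := intervalIntegral.integral_mono_on (a := -1) (b := 1) (μ := MeasureTheory.volume)
    (f := fun t => P t ^ 2 *
      (-(l * (a - 3 / 2)) * jacobiW (2 * a - 2) (2 * b + 1) t +
        l * (b + 1 / 2) * jacobiW (2 * a - 1) (2 * b) t +
        ((b + 1) * (5 - 4 * a) * jacobiW (2 * a - 2) (2 * b + 1) t +
          (b + 1) * (2 * b + 1) * jacobiW (2 * a - 1) (2 * b) t -
          (2 - a) * (2 * a - 2) * jacobiW (2 * a - 3) (2 * b + 2) t) / 2))
    (g := fun t => l * (2 * b + 1) * (P t ^ 2 * jacobiW (2 * a - 1) (2 * b) t) -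
      l * (a - 3 / 2) * (P t ^ 2 * jacobiW (2 * a - 2) (2 * b + 1) t))
    (by norm_num) (Continuous.intervalIntegrable (by fun_prop) _ _)
    (Continuous.intervalIntegrable (by fun_prop) _ _) (fun t ht => by
      have h₁ : 0 ≤ P t ^ 2 * jacobiW (2 * a - 2) (2 * b + 1) t :=
        mul_nonneg (sq_nonneg _) (jacobiW_nonneg _ _ ht)
      have h₂ : 0 ≤ P t ^ 2 * jacobiW (2 * a - 1) (2 * b) t :=
        mul_nonneg (sq_nonneg _) (jacobiW_nonneg _ _ ht)
      have h₃ : 0 ≤ P t ^ 2 * jacobiW (2 * a - 3) (2 * b + 2) t :=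
        mul_nonneg (sq_nonneg _) (jacobiW_nonneg _ _ ht)
      have e₁ := mul_nonneg (mul_nonneg (by linarith : 0 ≤ b + 1)
        (by linarith : 0 ≤ 4 * a - 5)) h₁
      have e₂ := mul_nonneg (mul_nonneg (by linarith : 0 ≤ l - (b + 1))
        (by linarith : 0 ≤ b + 1 / 2)) h₂
      have e₃ := mul_nonneg (mul_nonneg (by linarith : 0 ≤ 2 - a)
        (by linarith : 0 ≤ 2 * a - 2)) h₃
      linarith)
  rw [h.integral_virial_eq_zero ha hb, intervalIntegral.integral_sub
    (Continuous.intervalIntegrable (by fun_prop) _ _)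
    (Continuous.intervalIntegrable (by fun_prop) _ _), intervalIntegral.integral_const_mul,
    intervalIntegral.integral_const_mul, mul_assoc l, mul_assoc l, ← mul_sub] at hle
  have hpos : 0 < a - 3 / 2 := by linarith
  have := nonneg_of_mul_nonneg_right hle (by linarith)
  rw [div_mul_eq_mul_div, le_div_iff₀ hpos]
  linarith

theorem jacobiW_le_mul {a b : ℝ} {p q : ℝ} (hp : 0 ≤ p) (hq : 0 ≤ q) (ha : 0 < a) (hb : 0 < b)
    {t : ℝ} (ht : t ∈ Set.Icc (-1 : ℝ) 1) :
    jacobiW (a + p) (b + q) t ≤ 2 ^ p * 2 ^ q * jacobiW a b t := by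
  have hs : 0 ≤ 1 - t := by linarith [ht.2]
  have hr : 0 ≤ 1 + t := by linarith [ht.1]
  have h₁ : (1 - t) ^ p ≤ 2 ^ p := Real.rpow_le_rpow hs (by linarith [ht.1]) hp
  have h₂ : (1 + t) ^ q ≤ 2 ^ q := Real.rpow_le_rpow hr (by linarith [ht.2]) hq
  rw [jacobiW, jacobiW, Real.rpow_add_of_nonneg hs ha.le hp, Real.rpow_add_of_nonneg hr hb.le hq]
  calc (1 - t) ^ a * (1 - t) ^ p * ((1 + t) ^ b * (1 + t) ^ q) =
        (1 - t) ^ p * (1 + t) ^ q * ((1 - t) ^ a * (1 + t) ^ b) := by ring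
    _ ≤ _ := by gcongr

theorem integral_sq_mul_jacobiW_mono {P : ℝ → ℝ} (hP : Continuous P) {a b a' b' : ℝ} (ha : 0 < a)
    (hb : 0 < b) (ha' : a ≤ a') (hb' : b ≤ b') :
    ∫ t in (-1 : ℝ)..1, P t ^ 2 * jacobiW a' b' t ≤
      2 ^ (a' - a) * 2 ^ (b' - b) * ∫ t in (-1 : ℝ)..1, P t ^ 2 * jacobiW a b t := by
  have hW := continuous_jacobiW ha.le hb.le
  have hW' := continuous_jacobiW (ha.le.trans ha') (hb.le.trans hb')
  rw [← intervalIntegral.integral_const_mul]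
  refine intervalIntegral.integral_mono_on (by norm_num)
    (Continuous.intervalIntegrable (by fun_prop) _ _)
    (Continuous.intervalIntegrable (by fun_prop) _ _) fun t ht => ?_
  have h := jacobiW_le_mul (sub_nonneg.2 ha') (sub_nonneg.2 hb') ha hb ht
  rw [add_sub_cancel, add_sub_cancel] at h
  rw [mul_left_comm]
  exact mul_le_mul_of_nonneg_left h (sq_nonneg _)

theorem exists_integral_sq_mul_jacobiW_le {a b : ℝ} (ha : 3 / 2 < a) (hb : 0 < b) :
    ∃ K : ℝ, 0 ≤ K ∧ ∀ (l : ℝ) (P P₁ P₂ : ℝ → ℝ), IsJacobiSolution a b l P P₁ P₂ → b + 1 ≤ l →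
      ∫ t in (-1 : ℝ)..1, P t ^ 2 * jacobiW (2 * a - 2) (2 * b + 1) t ≤
        K * ∫ t in (-1 : ℝ)..1, P t ^ 2 * jacobiW a b t := by
  rcases le_total a 2 with ha' | ha'
  · have hpos : 0 < a - 3 / 2 := by linarith
    refine ⟨(2 * b + 1) / (a - 3 / 2) * (2 ^ (2 * a - 1 - a) * 2 ^ (2 * b - b)), by positivity,
      fun l P P₁ P₂ h hl => (h.integral_sq_mul_jacobiW_le ha ha' hb hl).trans ?_⟩
    rw [mul_assoc]
    exact mul_le_mul_of_nonneg_left (integral_sq_mul_jacobiW_mono h.continuous (by linarith) hb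
      (by linarith) (by linarith)) (by positivity)
  · exact ⟨2 ^ (2 * a - 2 - a) * 2 ^ (2 * b + 1 - b), by positivity, fun l P P₁ P₂ h _ =>
      integral_sq_mul_jacobiW_mono h.continuous (by linarith) hb (by linarith) (by linarith)⟩

theorem jacobiW_le_half_add {a b : ℝ} {t : ℝ} (ha : 0 < a) (hb : 0 < b)
    (ht : t ∈ Set.Icc (-1 : ℝ) 1) :
    jacobiW a b t ≤ (jacobiW a (b + 3) t + jacobiW (a + 3) b t) / 2 := by
  have hs : 0 ≤ 1 - t := by linarith [ht.2]
  have hr : 0 ≤ 1 + t := by linarith [ht.1]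
  have hs₃ : (1 - t) ^ (a + 3) = (1 - t) ^ a * (1 - t) ^ 3 := by
    rw [Real.rpow_add_of_nonneg hs ha.le (by norm_num)]
    norm_cast
  have hr₃ : (1 + t) ^ (b + 3) = (1 + t) ^ b * (1 + t) ^ 3 := by
    rw [Real.rpow_add_of_nonneg hr hb.le (by norm_num)]
    norm_cast
  have hW := jacobiW_nonneg a b ht
  rw [jacobiW] at hW
  rw [jacobiW, jacobiW, jacobiW, hs₃, hr₃]
  nlinarith [mul_nonneg hW (sq_nonneg t)]

theorem exists_integral_sq_mul_jacobiW_two_sided_le {a b : ℝ} (ha : 3 / 2 < a) (hb : 3 / 2 < b) :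
    ∃ K : ℝ, 0 ≤ K ∧ ∀ (l : ℝ) (P P₁ P₂ : ℝ → ℝ), IsJacobiSolution a b l P P₁ P₂ →
      a + 1 ≤ l → b + 1 ≤ l →
      ∫ t in (-1 : ℝ)..1, P t ^ 2 * jacobiW (2 * a - 2) (2 * b - 2) t ≤
        K * ∫ t in (-1 : ℝ)..1, P t ^ 2 * jacobiW a b t := by
  obtain ⟨K₁, hK₁, h₁⟩ := exists_integral_sq_mul_jacobiW_le ha (by linarith : 0 < b)
  obtain ⟨K₂, hK₂, h₂⟩ := exists_integral_sq_mul_jacobiW_le hb (by linarith : 0 < a)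
  refine ⟨K₁ + K₂, add_nonneg hK₁ hK₂, fun l P P₁ P₂ h hla hlb => ?_⟩
  have hP := h.continuous
  have hreflect : ∀ p q : ℝ, ∫ t in (-1 : ℝ)..1, P (-t) ^ 2 * jacobiW p q t =
      ∫ t in (-1 : ℝ)..1, P t ^ 2 * jacobiW q p t := by
    intro p q
    have := intervalIntegral.integral_comp_neg (a := -1) (b := 1)
      (fun t => P t ^ 2 * jacobiW q p t)
    simpa only [jacobiW_neg, neg_neg] using this
  have e₁ := h₁ l P P₁ P₂ h hlb
  have e₂ := h₂ l _ _ _ h.comp_neg hla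
  rw [hreflect, hreflect] at e₂
  have hW := continuous_jacobiW (a := 2 * a - 2) (b := 2 * b - 2) (by linarith) (by linarith)
  have hW₁ := continuous_jacobiW (a := 2 * a - 2) (b := 2 * b + 1) (by linarith) (by linarith)
  have hW₂ := continuous_jacobiW (a := 2 * a + 1) (b := 2 * b - 2) (by linarith) (by linarith)
  have hI : 0 ≤ ∫ t in (-1 : ℝ)..1, P t ^ 2 * jacobiW a b t :=
    intervalIntegral.integral_nonneg (by norm_num) fun t ht =>
      mul_nonneg (sq_nonneg _) (jacobiW_nonneg _ _ ht)
  calc _ ≤ ∫ t in (-1 : ℝ)..1, (1 / 2 * (P t ^ 2 * jacobiW (2 * a - 2) (2 * b + 1) t) +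
        1 / 2 * (P t ^ 2 * jacobiW (2 * a + 1) (2 * b - 2) t)) := by
        refine intervalIntegral.integral_mono_on (by norm_num)
          (Continuous.intervalIntegrable (by fun_prop) _ _)
          (Continuous.intervalIntegrable (by fun_prop) _ _) fun t ht => ?_
        have hle := jacobiW_le_half_add (a := 2 * a - 2) (b := 2 * b - 2) (by linarith)
          (by linarith) ht
        rw [show 2 * b - 2 + 3 = 2 * b + 1 by ring, show 2 * a - 2 + 3 = 2 * a + 1 by ring] at hle
        linarith [mul_le_mul_of_nonneg_left hle (sq_nonneg (P t))]
    _ ≤ _ := by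
      rw [intervalIntegral.integral_add (Continuous.intervalIntegrable (by fun_prop) _ _)
        (Continuous.intervalIntegrable (by fun_prop) _ _), intervalIntegral.integral_const_mul,
        intervalIntegral.integral_const_mul]
      linarith [mul_nonneg hK₁ hI, mul_nonneg hK₂ hI]

theorem sq_intervalIntegral_le {f : ℝ → ℝ} (hf : Continuous f) {a b : ℝ} (hab : a < b) :
    (∫ t in a..b, f t) ^ 2 ≤ (b - a) * ∫ t in a..b, f t ^ 2 := by
  have hpos : 0 < b - a := sub_pos.2 hab
  set m := (∫ t in a..b, f t) / (b - a) with hm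
  have h : 0 ≤ ∫ t in a..b, (f t - m) ^ 2 :=
    intervalIntegral.integral_nonneg hab.le fun t _ => sq_nonneg _
  have hexpand : ∫ t in a..b, (f t - m) ^ 2 =
      (∫ t in a..b, f t ^ 2) - 2 * m * (∫ t in a..b, f t) + (b - a) * m ^ 2 := by
    simp only [sub_sq, mul_right_comm 2 _ m]
    rw [intervalIntegral.integral_add (Continuous.intervalIntegrable (by fun_prop) _ _)
      (Continuous.intervalIntegrable (by fun_prop) _ _),
      intervalIntegral.integral_sub (Continuous.intervalIntegrable (by fun_prop) _ _)
      (Continuous.intervalIntegrable (by fun_prop) _ _), intervalIntegral.integral_const_mul,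
      intervalIntegral.integral_const, smul_eq_mul]
  have hI : ∫ t in a..b, f t = (b - a) * m := by
    rw [hm]
    field_simp
  rw [hexpand] at h
  rw [hI] at h ⊢
  nlinarith

theorem sum_integral_fin {f : ℝ → ℝ} (hf : Continuous f) {N : ℕ} (x : Fin (N + 1) → ℝ) :
    ∑ i : Fin N, ∫ t in (x i.castSucc)..(x i.succ), f t =
      ∫ t in (x 0)..(x (Fin.last N)), f t := by
  induction N with
  | zero => simp
  | succ N ih =>
    rw [Fin.sum_univ_castSucc]
    have h := ih fun i => x i.castSucc
    simp only [Fin.succ_castSucc, Fin.castSucc_zero] at h ⊢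
    rw [h, Fin.succ_last]
    exact intervalIntegral.integral_add_adjacent_intervals (hf.intervalIntegrable _ _)
      (hf.intervalIntegrable _ _)

theorem sum_mul_sq_average_le {f : ℝ → ℝ} (hf : Continuous f) {N : ℕ} {x : Fin (N + 1) → ℝ}
    (hx : StrictMono x) :
    ∑ i : Fin N, (x i.succ - x i.castSucc) *
        ((1 / (x i.succ - x i.castSucc)) * ∫ t in (x i.castSucc)..(x i.succ), f t) ^ 2 ≤
      ∫ t in (x 0)..(x (Fin.last N)), f t ^ 2 := by
  rw [← sum_integral_fin (f := fun t => f t ^ 2) (by fun_prop)]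
  refine Finset.sum_le_sum fun i _ => ?_
  have hlt : x i.castSucc < x i.succ := hx Fin.castSucc_lt_succ
  have hpos : 0 < x i.succ - x i.castSucc := sub_pos.2 hlt
  have h := sq_intervalIntegral_le hf hlt
  rw [mul_pow, one_div, inv_pow, ← mul_assoc, pow_two (x i.succ - x i.castSucc), mul_inv,
    mul_inv_cancel_left₀ hpos.ne', inv_mul_le_iff₀ hpos]
  exact h

theorem jacobiW_sq (a b : ℝ) {t : ℝ} (ht : t ∈ Set.Icc (-1 : ℝ) 1) :
    jacobiW a b t ^ 2 = jacobiW (2 * a) (2 * b) t := by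
  rw [jacobiW, jacobiW, mul_pow, ← Real.rpow_mul_natCast (by linarith [ht.2]),
    ← Real.rpow_mul_natCast (by linarith [ht.1])]
  simp only [Nat.cast_ofNat, mul_comm]

theorem exists_integral_jacobiP_sq_mul_jacobiW_le {α β : ℝ} (hα : 1 / 2 < α) (hβ : 1 / 2 < β) :
    ∃ C : ℝ, 0 < C ∧ ∀ n : ℕ,
      ∫ t in (-1 : ℝ)..1, (jacobiP n (α + 1) (β + 1) t * jacobiW α β t) ^ 2 ≤ C / (n + 1) := by
  obtain ⟨K, hK, hbound⟩ := exists_integral_sq_mul_jacobiW_two_sided_le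
    (by linarith : 3 / 2 < α + 1) (by linarith : 3 / 2 < β + 1)
  set I₀ := ∫ t in (-1 : ℝ)..1, (jacobiP 0 (α + 1) (β + 1) t * jacobiW α β t) ^ 2 with hI₀
  have hI₀_nonneg : 0 ≤ I₀ := intervalIntegral.integral_nonneg (by norm_num) fun t _ => sq_nonneg _
  refine ⟨I₀ + K * 2 ^ (α + 1 + (β + 1) + 1) + 1, by positivity, fun n => ?_⟩
  rcases n.eq_zero_or_pos with rfl | hn
  · have : 0 ≤ K * 2 ^ (α + 1 + (β + 1) + 1) := by positivity
    rw [← hI₀, Nat.cast_zero, zero_add, div_one]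
    linarith
  · have hn' : (1 : ℝ) ≤ n := by exact_mod_cast hn
    have hode := isJacobiSolution_jacobiP n (by linarith : 0 ≤ α + 1) (by linarith : 0 ≤ β + 1)
    have h := hbound _ _ _ _ hode (by nlinarith) (by nlinarith)
    rw [show 2 * (α + 1) - 2 = 2 * α by ring, show 2 * (β + 1) - 2 = 2 * β by ring] at h
    calc _ = ∫ t in (-1 : ℝ)..1, jacobiP n (α + 1) (β + 1) t ^ 2 * jacobiW (2 * α) (2 * β) t := by
          refine intervalIntegral.integral_congr fun t ht => ?_
          rw [Set.uIcc_of_le (by norm_num)] at ht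
          simp only [mul_pow, jacobiW_sq α β ht]
      _ ≤ _ := h
      _ ≤ K * (2 ^ (α + 1 + (β + 1) + 1) / (n + 1)) :=
          mul_le_mul_of_nonneg_left (integral_jacobiP_sq_le n (by linarith) (by linarith)) hK
      _ ≤ _ := by
          rw [← mul_div_assoc]
          gcongr
          linarith

/-- Weighted column bound for the histopolation matrix: for `α, β > 1/2` there is `C > 0`
such that for any partition of `[-1,1]` and any column `j`,
`∑_i h_i |[H_N]_{i,j}|² ≤ C/j`. -/
theorem weighted_histopolation_column_bound (α β : ℝ)
    (hα : (1 : ℝ) / 2 < α) (hβ : (1 : ℝ) / 2 < β) :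
    ∃ C : ℝ, 0 < C ∧ ∀ (N : ℕ) (x : Fin (N + 1) → ℝ), StrictMono x →
      x 0 = -1 → x (Fin.last N) = 1 → ∀ j : Fin N,
        ∑ i : Fin N, (x i.succ - x i.castSucc) *
            ((1 / (x i.succ - x i.castSucc)) *
              ∫ t in (x i.castSucc)..(x i.succ),
                jacobiP j (α + 1) (β + 1) t * jacobiW α β t) ^ 2 ≤
          C / ((j : ℝ) + 1) := by
  obtain ⟨C, hC, hbound⟩ := exists_integral_jacobiP_sq_mul_jacobiW_le hα hβ
  refine ⟨C, hC, fun N x hx hx₀ hx₁ j => ?_⟩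
  have hf : Continuous fun t => jacobiP j (α + 1) (β + 1) t * jacobiW α β t :=
    (continuous_jacobiP _ _ _).mul (continuous_jacobiW (by linarith) (by linarith))
  have h := sum_mul_sq_average_le hf hx
  rw [hx₀, hx₁] at h
  exact h.trans (hbound j)
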